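/- arXiv:2505.24321 — 3 statements merged into one kernel-verified Lean document; each statement's English description precedes it below -/
import Mathlib

section
/- For every deterministic online algorithm for goods, there exists a goods instance with n = 2 agents having identical monotone submodular valuation functions (v_1 = v_2) such that the final allocation A^t produced by the algorithm is not non-wasteful. In particular, for submodular valuation functions, no deterministic online algorithm can compute a non-wasteful allocation, even for two agents with identical valuations. -/
open Finset

namespace OnlineFair

/-- The valuation/cost profile restricted to the items `0, …, k` that have arrived
by the end of (0-indexed) round `k`: an online algorithm's decision at round `k`
may depend only on this restriction. -/
def restrictVal {n : ℕ} (v : Fin n → Finset ℕ → ℝ) (k : ℕ) : Fin n → Finset ℕ → ℝ :=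
  fun i S => v i (S ∩ Finset.range (k + 1))

/-- A deterministic online algorithm for goods with `n` agents: at each round it sees
only the valuations restricted to the arrived items, and either assigns the newly
arrived item to an agent or discards it (`none`). -/
abbrev GoodsAlg (n : ℕ) : Type := ℕ → (Fin n → Finset ℕ → ℝ) → Option (Fin n)

/-- The allocation produced by a goods algorithm after `k` rounds
(the arrived items are `0, …, k-1`; item `k-1` arrived in the last round). -/
def runGoods {n : ℕ} (alg : GoodsAlg n) (v : Fin n → Finset ℕ → ℝ) : ℕ → Fin n → Finset ℕ
  | 0 => fun _ => ∅
  | k + 1 => fun i =>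
      match alg k (restrictVal v k) with
      | some j => if i = j then insert k (runGoods alg v k i) else runGoods alg v k i
      | none => runGoods alg v k i

/-- A deterministic online algorithm for chores with `n` agents: every arriving chore
must be assigned to some agent, based only on the costs restricted to arrived chores. -/
abbrev ChoresAlg (n : ℕ) : Type := ℕ → (Fin n → Finset ℕ → ℝ) → Fin n

/-- The (complete) allocation produced by a chores algorithm after `k` rounds. -/
def runChores {n : ℕ} (alg : ChoresAlg n) (c : Fin n → Finset ℕ → ℝ) : ℕ → Fin n → Finset ℕ
  | 0 => fun _ => ∅
  | k + 1 => fun i =>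
      if i = alg k (restrictVal c k) then insert k (runChores alg c k i)
      else runChores alg c k i

/-- A normalized monotone (hence nonnegative) valuation / cost function. -/
def IsVal (v : Finset ℕ → ℝ) : Prop :=
  v ∅ = 0 ∧ ∀ S T : Finset ℕ, S ⊆ T → v S ≤ v T

/-- Additive set function. -/
def AdditiveVal (v : Finset ℕ → ℝ) : Prop :=
  ∀ S : Finset ℕ, v S = ∑ e ∈ S, v {e}

/-- Tri-valued singleton values: `v {e} ∈ {a, b, z}` with `0 < a ≤ b ≤ z`. -/
def TriValuedVal (v : Finset ℕ → ℝ) : Prop :=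
  ∃ a b z : ℝ, 0 < a ∧ a ≤ b ∧ b ≤ z ∧ ∀ e : ℕ, v {e} = a ∨ v {e} = b ∨ v {e} = z

/-- Bi-valued singleton values: `v {e} ∈ {a, b}` with `0 < a ≤ b`. -/
def BiValuedVal (v : Finset ℕ → ℝ) : Prop :=
  ∃ a b : ℝ, 0 < a ∧ a ≤ b ∧ ∀ e : ℕ, v {e} = a ∨ v {e} = b

/-- Binary singleton values: `v {e} ∈ {0, 1}`. -/
def BinaryVal (v : Finset ℕ → ℝ) : Prop :=
  ∀ e : ℕ, v {e} = 0 ∨ v {e} = 1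

def Submodular (v : Finset ℕ → ℝ) : Prop :=
  ∀ X Y : Finset ℕ, v (X ∪ Y) + v (X ∩ Y) ≤ v X + v Y

def Supermodular (v : Finset ℕ → ℝ) : Prop :=
  ∀ X Y : Finset ℕ, v X + v Y ≤ v (X ∪ Y) + v (X ∩ Y)

/-- Every marginal value `v (X ∪ {e}) - v X` lies in `{0, 1}`. -/
def BinaryMarginals (v : Finset ℕ → ℝ) : Prop :=
  ∀ (X : Finset ℕ) (e : ℕ), v (insert e X) = v X ∨ v (insert e X) = v X + 1

/-- Submodular binary valuation (equivalently, a matroid rank function). -/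
def SubmodularBinary (v : Finset ℕ → ℝ) : Prop :=
  IsVal v ∧ Submodular v ∧ BinaryMarginals v

/-- Supermodular binary cost function. -/
def SupermodularBinary (v : Finset ℕ → ℝ) : Prop :=
  IsVal v ∧ Supermodular v ∧ BinaryMarginals v

/-- `B` is an allocation of (part of) the item set `T`:
pairwise disjoint bundles of items from `T`. -/
def IsAlloc (n : ℕ) (T : Finset ℕ) (B : Fin n → Finset ℕ) : Prop :=
  (∀ i, B i ⊆ T) ∧ ∀ i j, i ≠ j → Disjoint (B i) (B j)

/-- Every item of `T` is assigned to some agent. -/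
def Complete (n : ℕ) (T : Finset ℕ) (A : Fin n → Finset ℕ) : Prop :=
  ∀ e ∈ T, ∃ i, e ∈ A i

/-- `B` is a partition of `T` into `n` (possibly empty) bundles. -/
def IsPartition (n : ℕ) (T : Finset ℕ) (B : Fin n → Finset ℕ) : Prop :=
  IsAlloc n T B ∧ Complete n T B

/-- Non-wastefulness of the allocation `A` of the arrived goods `T`:
every allocated good has strictly positive marginal value inside its bundle, and
every discarded good has zero marginal value with respect to every agent's bundle. -/
def NonWasteful (n : ℕ) (v : Fin n → Finset ℕ → ℝ) (T : Finset ℕ)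
    (A : Fin n → Finset ℕ) : Prop :=
  (∀ i, ∀ e ∈ A i, v i ((A i).erase e) < v i (A i)) ∧
  (∀ i, ∀ e ∈ T, (∀ j, e ∉ A j) → v i (insert e (A i)) = v i (A i))

/-- `α`-EF1 for goods. -/
def EF1Goods (n : ℕ) (α : ℝ) (v : Fin n → Finset ℕ → ℝ) (A : Fin n → Finset ℕ) : Prop :=
  ∀ i j : Fin n, (A j).Nonempty → ∃ e ∈ A j, α * v i ((A j).erase e) ≤ v i (A i)

/-- `α`-MMS for goods: for every `n`-partition `B` of the arrived items, agent `i`'s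
value is at least `α` times the minimum bundle value of `B` (i.e. at least `α` times
the value of some bundle of `B`); this says `v i (A i) ≥ α · MMS_i`. -/
def MMSGoods (n : ℕ) (α : ℝ) (v : Fin n → Finset ℕ → ℝ) (T : Finset ℕ)
    (A : Fin n → Finset ℕ) : Prop :=
  ∀ i : Fin n, ∀ B : Fin n → Finset ℕ, IsPartition n T B → ∃ j, α * v i (B j) ≤ v i (A i)

/-- `α`-max-USW: the utilitarian social welfare of `A` is at least `α` times that of
any allocation of the arrived items. -/
def MaxUSW (n : ℕ) (α : ℝ) (v : Fin n → Finset ℕ → ℝ) (T : Finset ℕ)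
    (A : Fin n → Finset ℕ) : Prop :=
  ∀ B : Fin n → Finset ℕ, IsAlloc n T B → α * ∑ i, v i (B i) ≤ ∑ i, v i (A i)

/-- `α`-EF1 for chores. -/
def EF1Chores (n : ℕ) (α : ℝ) (c : Fin n → Finset ℕ → ℝ) (A : Fin n → Finset ℕ) : Prop :=
  ∀ i j : Fin n, (A i).Nonempty → ∃ e ∈ A i, c i ((A i).erase e) ≤ α * c i (A j)

/-- `α`-MMS (minimax share) for chores: for every `n`-partition `B` of the arrived
chores, agent `i`'s cost is at most `α` times the maximum bundle cost of `B`
(i.e. at most `α` times the cost of some bundle of `B`); this says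
`c i (A i) ≤ α · MMS_i`. -/
def MMSChores (n : ℕ) (α : ℝ) (c : Fin n → Finset ℕ → ℝ) (T : Finset ℕ)
    (A : Fin n → Finset ℕ) : Prop :=
  ∀ i : Fin n, ∀ B : Fin n → Finset ℕ, IsPartition n T B → ∃ j, c i (A i) ≤ α * c i (B j)

/-- `α`-min-USC: the utilitarian social cost of `A` is at most `α` times that of any
complete allocation of the arrived chores. -/
def MinUSC (n : ℕ) (α : ℝ) (c : Fin n → Finset ℕ → ℝ) (T : Finset ℕ)
    (A : Fin n → Finset ℕ) : Prop :=
  ∀ B : Fin n → Finset ℕ, IsPartition n T B → ∑ i, c i (A i) ≤ α * ∑ i, c i (B i)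

/-- The valuation of a bundle by its most valuable good, where good `e` has value `e + 1`. -/
def maxVal (S : Finset ℕ) : ℝ := ((S.sup Nat.succ : ℕ) : ℝ)

theorem isVal_maxVal : IsVal maxVal := by
  refine ⟨by simp [maxVal], fun S T h => ?_⟩
  simp only [maxVal, Nat.cast_le]
  exact Finset.sup_mono h

theorem submodular_maxVal : Submodular maxVal := by
  intro X Y
  have hX : (X ∩ Y).sup Nat.succ ≤ X.sup Nat.succ := Finset.sup_mono Finset.inter_subset_left
  have hY : (X ∩ Y).sup Nat.succ ≤ Y.sup Nat.succ := Finset.sup_mono Finset.inter_subset_right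
  have hU : (X ∪ Y).sup Nat.succ = max (X.sup Nat.succ) (Y.sup Nat.succ) := Finset.sup_union
  simp only [maxVal]
  norm_cast
  omega

theorem sup_succ_le_of_subset_range {S : Finset ℕ} {k : ℕ} (h : S ⊆ Finset.range k) :
    S.sup Nat.succ ≤ k :=
  Finset.sup_le fun _ he => Finset.mem_range.1 (h he)

theorem maxVal_insert {S : Finset ℕ} {k : ℕ} (h : S ⊆ Finset.range k) :
    maxVal (insert k S) = k + 1 := by
  have := sup_succ_le_of_subset_range h
  have hi : (insert k S).sup Nat.succ = k + 1 := by
    rw [Finset.sup_insert]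
    exact max_eq_left (this.trans k.le_succ)
  rw [maxVal, hi, Nat.cast_add_one]

theorem maxVal_lt {S : Finset ℕ} {k : ℕ} (h : S ⊆ Finset.range k) :
    maxVal S < k + 1 := by
  have := sup_succ_le_of_subset_range h
  simp only [maxVal]
  exact_mod_cast Nat.lt_succ_of_le this

theorem runGoods_subset_range {n : ℕ} (alg : GoodsAlg n) (v : Fin n → Finset ℕ → ℝ)
    (k : ℕ) (i : Fin n) : runGoods alg v k i ⊆ Finset.range k := by
  induction k with
  | zero => simp [runGoods]
  | succ k ih =>
    have hk : runGoods alg v k i ⊆ Finset.range (k + 1) :=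
      ih.trans (Finset.range_mono k.le_succ)
    have hi : insert k (runGoods alg v k i) ⊆ Finset.range (k + 1) :=
      Finset.insert_subset (by simp) hk
    simp only [runGoods]
    split
    · split_ifs <;> assumption
    · exact hk

/-- If every agent values bundles by `maxVal`, staying non-wasteful in the next round forces the
algorithm to give the arriving good to an agent with an empty bundle. -/
theorem exists_empty_of_nonWasteful {n : ℕ} [NeZero n] (alg : GoodsAlg n) (k : ℕ)
    (h : NonWasteful n (fun _ => maxVal) (Finset.range (k + 1))
      (runGoods alg (fun _ => maxVal) (k + 1))) :
    ∃ j, runGoods alg (fun _ => maxVal) k j = ∅ ∧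
      runGoods alg (fun _ => maxVal) (k + 1) =
        Function.update (runGoods alg (fun _ => maxVal) k) j {k} := by
  have hsub := runGoods_subset_range alg (fun _ => maxVal) k
  obtain ⟨hpos, hzero⟩ := h
  cases hj : alg k (restrictVal (fun _ => maxVal) k) with
  | none =>
    have hrun : runGoods alg (fun _ => maxVal) (k + 1) = runGoods alg (fun _ => maxVal) k := by
      funext i
      simp [runGoods, hj]
    rw [hrun] at hzero
    have heq := hzero 0 k (by simp) fun i hi => by simpa using hsub i hi
    have hlt := maxVal_lt (hsub 0)
    simp only [maxVal_insert (hsub 0)] at heq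
    linarith
  | some j =>
    have hrun : ∀ i, runGoods alg (fun _ => maxVal) (k + 1) i =
        if i = j then insert k (runGoods alg (fun _ => maxVal) k i)
        else runGoods alg (fun _ => maxVal) k i := by
      intro i
      simp [runGoods, hj]
    have hempty : runGoods alg (fun _ => maxVal) k j = ∅ := by
      by_contra hne
      obtain ⟨e, he⟩ := Finset.nonempty_iff_ne_empty.2 hne
      have hek : k ≠ e := (Finset.mem_range.1 (hsub j he)).ne'
      have hlt := hpos j e (by simp [hrun, he])
      rw [hrun, if_pos rfl, Finset.erase_insert_of_ne hek] at hlt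
      beta_reduce at hlt
      rw [maxVal_insert (hsub j), maxVal_insert ((Finset.erase_subset _ _).trans (hsub j))] at hlt
      exact lt_irrefl _ hlt
    refine ⟨j, hempty, funext fun i => ?_⟩
    rw [hrun, Function.update_apply]
    split_ifs with hi
    · simp [hi, hempty]
    · rfl

/-- for (monotone) submodular valuations, no deterministic online goods
algorithm can compute a non-wasteful allocation, even for two agents with identical
valuation functions. -/
theorem goods_submodular_no_NW :
    ∀ alg : GoodsAlg 2,
    ∃ (t : ℕ) (v : Fin 2 → Finset ℕ → ℝ),
      v 0 = v 1 ∧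
      (∀ i, IsVal (v i)) ∧ (∀ i, Submodular (v i)) ∧
      ¬ NonWasteful 2 v (Finset.range t) (runGoods alg v t) := by
  intro alg
  by_contra! h
  have hNW (t : ℕ) := h t (fun _ => maxVal) rfl (fun _ => isVal_maxVal) fun _ => submodular_maxVal
  obtain ⟨a, -, ha⟩ := exists_empty_of_nonWasteful alg 0 (hNW 1)
  obtain ⟨b, hb, hb'⟩ := exists_empty_of_nonWasteful alg 1 (hNW 2)
  obtain ⟨c, hc, -⟩ := exists_empty_of_nonWasteful alg 2 (hNW 3)
  simp only [zero_add, Nat.reduceAdd] at ha hb' hb hc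
  have hba : b ≠ a := by
    rintro rfl
    simp [ha] at hb
  have hcb : c ≠ b := by
    rintro rfl
    simp [hb'] at hc
  have hca : c ≠ a := by
    rintro rfl
    simp [hb', ha, Function.update_of_ne hcb] at hc
  omega

end OnlineFair
end

section
/- For every deterministic online algorithm for chores, there exists a chores instance with two agents having supermodular binary cost functions such that the final complete allocation A^t produced by the algorithm fails α-EF1 for every α ≥ 1. In particular, for supermodular binary cost functions no deterministic online algorithm can achieve α-EF1 and completeness for any α ≥ 1. -/
open Finset

namespace OnlineFair

/-- The cost of a bundle `S` is the number of chores of `S` outside `Z` in excess of `k`: the nullity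
function of the direct sum of a free matroid on `Z` and a uniform matroid of rank `k` elsewhere. -/
def excessCost (Z : Finset ℕ) (k : ℕ) (S : Finset ℕ) : ℝ :=
  ((#(S \ Z) - k : ℕ) : ℝ)

lemma supermodularBinary_excessCost (Z : Finset ℕ) (k : ℕ) :
    SupermodularBinary (excessCost Z k) := by
  refine ⟨⟨by simp [excessCost], fun S T h => ?_⟩, fun X Y => ?_, fun X e => ?_⟩
  · have := card_le_card (sdiff_subset_sdiff h (subset_refl Z))
    simp only [excessCost]
    exact_mod_cast Nat.sub_le_sub_right this k
  · have hadd := card_union_add_card_inter (X \ Z) (Y \ Z)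
    have hX : #(X \ Z) ≤ #(X \ Z ∪ Y \ Z) := card_le_card subset_union_left
    have hY : #(Y \ Z) ≤ #(X \ Z ∪ Y \ Z) := card_le_card subset_union_right
    have hunion : (X ∪ Y) \ Z = X \ Z ∪ Y \ Z := union_sdiff_distrib X Y Z
    have hinter : (X ∩ Y) \ Z = X \ Z ∩ (Y \ Z) := by grind
    simp only [excessCost, hunion, hinter]
    norm_cast
    omega
  · have hle : #(X \ Z) ≤ #(insert e X \ Z) :=
      card_le_card (sdiff_subset_sdiff (subset_insert e X) (subset_refl Z))
    have hsub : insert e X \ Z ⊆ insert e (X \ Z) := by grind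
    have hge := (card_le_card hsub).trans (card_insert_le e _)
    simp only [excessCost]
    norm_cast
    omega

lemma excessCost_inter_eq_zero {Z : Finset ℕ} {k : ℕ} {T : Finset ℕ} (h : #(T \ Z) ≤ k)
    (S : Finset ℕ) : excessCost Z k (S ∩ T) = 0 := by
  have := card_le_card (sdiff_subset_sdiff (inter_subset_right : S ∩ T ⊆ T) (subset_refl Z))
  simp only [excessCost, Nat.cast_eq_zero]
  omega

/-- An allocation in which agent `x` has excess at least `2` in its own bundle and no cost for the
other bundle is not `α`-EF1 for any `α`. -/
lemma not_ef1Chores_of_card {n : ℕ} {c : Fin n → Finset ℕ → ℝ} {A : Fin n → Finset ℕ}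
    {x y : Fin n} {Z : Finset ℕ} {k : ℕ} (hc : c x = excessCost Z k)
    (hx : k + 2 ≤ #(A x \ Z)) (hy : #(A y \ Z) ≤ k) (α : ℝ) : ¬ EF1Chores n α c A := by
  intro h
  have hne : (A x).Nonempty := by
    rw [nonempty_iff_ne_empty]
    intro h0
    simp [h0] at hx
  obtain ⟨e, -, he⟩ := h x y hne
  have hcard : #(A x \ Z) ≤ #((A x).erase e \ Z) + 1 := by
    have hsub : A x \ Z ⊆ insert e ((A x).erase e \ Z) := by grind
    exact (card_le_card hsub).trans (card_insert_le e _)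
  simp only [hc, excessCost, Nat.sub_eq_zero_of_le hy, Nat.cast_zero, mul_zero] at he
  have : #((A x).erase e \ Z) - k = 0 := by
    exact_mod_cast le_antisymm he (Nat.cast_nonneg _)
  omega

lemma runChores_subset_range {n : ℕ} (alg : ChoresAlg n) (c : Fin n → Finset ℕ → ℝ) (t : ℕ)
    (x : Fin n) : runChores alg c t x ⊆ range t := by
  induction t with
  | zero => simp [runChores]
  | succ t ih =>
    simp only [runChores]
    grind

lemma card_runChores_succ_sdiff {n : ℕ} (alg : ChoresAlg n) (c : Fin n → Finset ℕ → ℝ) {t : ℕ}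
    {Z : Finset ℕ} (hZ : t ∉ Z) (x : Fin n) :
    #(runChores alg c (t + 1) x \ Z) =
      #(runChores alg c t x \ Z) + if x = alg t (restrictVal c t) then 1 else 0 := by
  have ht : t ∉ runChores alg c t x := fun h => by
    simpa using runChores_subset_range alg c t x h
  simp only [runChores]
  split_ifs with h
  · rw [insert_sdiff_of_notMem _ hZ, card_insert_of_notMem (by simp [ht])]
  · simp

/-- Two-agent cost profile giving `f` to agent `i` and `g` to the other one. -/
def costProfile (i : Fin 2) (f g : Finset ℕ → ℝ) (x : Fin 2) : Finset ℕ → ℝ :=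
  if x = i then f else g

lemma restrictVal_costProfile_congr {i : Fin 2} {f f' g g' : Finset ℕ → ℝ} {k : ℕ}
    (hf : ∀ S, f (S ∩ range (k + 1)) = f' (S ∩ range (k + 1)))
    (hg : ∀ S, g (S ∩ range (k + 1)) = g' (S ∩ range (k + 1))) :
    restrictVal (costProfile i f g) k = restrictVal (costProfile i f' g') k := by
  funext x S
  simp only [restrictVal, costProfile]
  split_ifs
  exacts [hf S, hg S]

lemma supermodularBinary_costProfile (i : Fin 2) (Z Z' : Finset ℕ) (k k' : ℕ) (x : Fin 2) :
    SupermodularBinary (costProfile i (excessCost Z k) (excessCost Z' k') x) := by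
  simp only [costProfile]
  split_ifs <;> exact supermodularBinary_excessCost _ _

/-- If after `s` rounds each agent's own bundle has exhausted its rank while the other bundle has not,
then three more chores force a violation of EF1. -/
lemma exists_not_ef1Chores_of_saturated (alg : ChoresAlg 2) {i j : Fin 2} (hij : i ≠ j)
    {Z Z' : Finset ℕ} {k k' s : ℕ} {c : Fin 2 → Finset ℕ → ℝ}
    (hc : c = costProfile i (excessCost Z k) (excessCost Z' k'))
    (hZ : Z ⊆ range s) (hZ' : Z' ⊆ range s)
    (hii : k ≤ #(runChores alg c s i \ Z)) (hji : #(runChores alg c s j \ Z) + 1 ≤ k)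
    (hjj : k' ≤ #(runChores alg c s j \ Z')) (hij' : #(runChores alg c s i \ Z') + 1 ≤ k') :
    ∃ (t : ℕ) (c : Fin 2 → Finset ℕ → ℝ), (∀ i, SupermodularBinary (c i)) ∧
      ∀ α : ℝ, 1 ≤ α → ¬ EF1Chores 2 α c (runChores alg c t) := by
  have hnot {W : Finset ℕ} (hW : W ⊆ range s) (m : ℕ) : s + m ∉ W := fun h => by
    have := mem_range.1 (hW h)
    omega
  have step {W : Finset ℕ} (hW : W ⊆ range s) (x : Fin 2) :
      #(runChores alg c (s + 3) x \ W) = #(runChores alg c s x \ W)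
        + (if x = alg s (restrictVal c s) then 1 else 0)
        + (if x = alg (s + 1) (restrictVal c (s + 1)) then 1 else 0)
        + (if x = alg (s + 2) (restrictVal c (s + 2)) then 1 else 0) := by
    rw [card_runChores_succ_sdiff alg c (hnot hW 2), card_runChores_succ_sdiff alg c (hnot hW 1),
      card_runChores_succ_sdiff alg c (hnot hW 0)]
    rfl
  have one (d : Fin 2) :
      (if i = d then 1 else 0) + (if j = d then 1 else 0) = 1 := by
    split_ifs <;> omega
  have h0 := one (alg s (restrictVal c s))
  have h1 := one (alg (s + 1) (restrictVal c (s + 1)))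
  have h2 := one (alg (s + 2) (restrictVal c (s + 2)))
  have hi := step hZ i
  have hj := step hZ j
  have hi' := step hZ' i
  have hj' := step hZ' j
  refine ⟨s + 3, c, fun x => hc ▸ supermodularBinary_costProfile i Z Z' k k' x, fun α _ => ?_⟩
  by_cases hwin : k + 2 ≤ #(runChores alg c (s + 3) i \ Z) ∧ #(runChores alg c (s + 3) j \ Z) ≤ k
  · exact not_ef1Chores_of_card (by simp [hc, costProfile]) hwin.1 hwin.2 α
  · refine not_ef1Chores_of_card (x := j) (y := i) (Z := Z') (k := k')
      (by simp [hc, costProfile, hij.symm]) ?_ ?_ α <;> omega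

/-- for supermodular binary cost functions, no deterministic online
chores algorithm achieves `α`-EF1 and completeness, for any `α ≥ 1`. -/
theorem chores_supermodularBinary_no_EF1 :
    ∀ alg : ChoresAlg 2,
    ∃ (t : ℕ) (c : Fin 2 → Finset ℕ → ℝ),
      (∀ i, SupermodularBinary (c i)) ∧
      ∀ α : ℝ, 1 ≤ α → ¬ EF1Chores 2 α c (runChores alg c t) := by
  intro alg
  have zero_congr {Z W : Finset ℕ} {k l m : ℕ} (hZ : #(range (m + 1) \ Z) ≤ k)
      (hW : #(range (m + 1) \ W) ≤ l) (S : Finset ℕ) :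
      excessCost Z k (S ∩ range (m + 1)) = excessCost W l (S ∩ range (m + 1)) := by
    rw [excessCost_inter_eq_zero hZ, excessCost_inter_eq_zero hW]
  obtain ⟨i, hi⟩ : ∃ i, i = alg 0 (restrictVal (fun _ => excessCost ∅ 2) 0) := ⟨_, rfl⟩
  obtain ⟨j, hij⟩ : ∃ j, i ≠ j := (exists_ne i).imp fun _ => Ne.symm
  have eq_j {d : Fin 2} (hd : i ≠ d) : j = d := by
    omega
  have hconst : (fun _ => excessCost ∅ 2) = costProfile i (excessCost ∅ 2) (excessCost ∅ 2) := by
    funext x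
    simp [costProfile]
  rw [hconst] at hi
  by_cases h1 : i = alg 1 (restrictVal (costProfile i (excessCost ∅ 2) (excessCost ∅ 2)) 1)
  swap
  · set c := costProfile i (excessCost {1} 1) (excessCost {0} 1) with hc
    have d0 : alg 0 (restrictVal c 0) = i := by
      refine (hi.trans (congrArg (alg _) ?_)).symm
      exact restrictVal_costProfile_congr (zero_congr (by decide) (by decide))
        (zero_congr (by decide) (by decide))
    have d1 : alg 1 (restrictVal c 1) = j := by
      refine ((eq_j h1).trans (congrArg (alg _) ?_)).symm
      exact restrictVal_costProfile_congr (zero_congr (by decide) (by decide))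
        (zero_congr (by decide) (by decide))
    have ri : runChores alg c 2 i = {0} := by simp [runChores, d0, d1, hij]
    have rj : runChores alg c 2 j = {1} := by simp [runChores, d0, d1, hij.symm]
    apply exists_not_ef1Chores_of_saturated alg hij hc (s := 2) <;> first
      | (rw [ri]; decide)
      | (rw [rj]; decide)
      | decide
  by_cases h2 : i = alg 2 (restrictVal (costProfile i (excessCost ∅ 2) (excessCost ∅ 4)) 2)
  swap
  · set c := costProfile i (excessCost ∅ 2) (excessCost {0, 1} 1) with hc
    have d0 : alg 0 (restrictVal c 0) = i := by
      refine (hi.trans (congrArg (alg _) ?_)).symm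
      exact restrictVal_costProfile_congr (fun _ => rfl)
        (zero_congr (by decide) (by decide))
    have d1 : alg 1 (restrictVal c 1) = i := by
      refine (h1.trans (congrArg (alg _) ?_)).symm
      exact restrictVal_costProfile_congr (fun _ => rfl)
        (zero_congr (by decide) (by decide))
    have d2 : alg 2 (restrictVal c 2) = j := by
      refine ((eq_j h2).trans (congrArg (alg _) ?_)).symm
      exact restrictVal_costProfile_congr (fun _ => rfl)
        (zero_congr (by decide) (by decide))
    have ri : runChores alg c 3 i = {1, 0} := by simp [runChores, d0, d1, d2, hij]
    have rj : runChores alg c 3 j = {2} := by simp [runChores, d0, d1, d2, hij.symm]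
    apply exists_not_ef1Chores_of_saturated alg hij hc (s := 3) <;> first
      | (rw [ri]; decide)
      | (rw [rj]; decide)
      | decide
  by_cases h3 : i = alg 3 (restrictVal (costProfile i (excessCost ∅ 2) (excessCost ∅ 4)) 3)
  · set c := costProfile i (excessCost ∅ 2) (excessCost ∅ 4) with hc
    have d0 : alg 0 (restrictVal c 0) = i := by
      refine (hi.trans (congrArg (alg _) ?_)).symm
      exact restrictVal_costProfile_congr (fun _ => rfl)
        (zero_congr (by decide) (by decide))
    have d1 : alg 1 (restrictVal c 1) = i := by
      refine (h1.trans (congrArg (alg _) ?_)).symm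
      exact restrictVal_costProfile_congr (fun _ => rfl)
        (zero_congr (by decide) (by decide))
    have ri : runChores alg c 4 i = {3, 2, 1, 0} := by simp [runChores, d0, d1, ← h2, ← h3]
    have rj : runChores alg c 4 j = ∅ := by simp [runChores, d0, d1, ← h2, ← h3, hij.symm]
    refine ⟨4, c, supermodularBinary_costProfile i _ _ _ _, fun α _ =>
      not_ef1Chores_of_card (x := i) (y := j) (Z := ∅) (k := 2) (by simp [hc, costProfile]) ?_ ?_ α⟩
    · rw [ri]; decide
    · rw [rj]; decide
  · set c := costProfile i (excessCost ∅ 2) (excessCost {0, 1, 2} 1) with hc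
    have d0 : alg 0 (restrictVal c 0) = i := by
      refine (hi.trans (congrArg (alg _) ?_)).symm
      exact restrictVal_costProfile_congr (fun _ => rfl)
        (zero_congr (by decide) (by decide))
    have d1 : alg 1 (restrictVal c 1) = i := by
      refine (h1.trans (congrArg (alg _) ?_)).symm
      exact restrictVal_costProfile_congr (fun _ => rfl)
        (zero_congr (by decide) (by decide))
    have d2 : alg 2 (restrictVal c 2) = i := by
      refine (h2.trans (congrArg (alg _) ?_)).symm
      exact restrictVal_costProfile_congr (fun _ => rfl)
        (zero_congr (by decide) (by decide))
    have d3 : alg 3 (restrictVal c 3) = j := by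
      refine ((eq_j h3).trans (congrArg (alg _) ?_)).symm
      exact restrictVal_costProfile_congr (fun _ => rfl)
        (zero_congr (by decide) (by decide))
    have ri : runChores alg c 4 i = {2, 1, 0} := by simp [runChores, d0, d1, d2, d3, hij]
    have rj : runChores alg c 4 j = {3} := by simp [runChores, d0, d1, d2, d3, hij.symm]
    apply exists_not_ef1Chores_of_saturated alg hij hc (s := 4) <;> first
      | (rw [ri]; decide)
      | (rw [rj]; decide)
      | decide

end OnlineFair
end

section
/- For every deterministic online algorithm for chores, there exists a chores instance with two agents having supermodular binary cost functions such that the final complete allocation A^t produced by the algorithm fails α-MMS for every α ≥ 1 and also fails α-min-USC for every α ≥ 1 (indeed, some agent with minimax share 0 incurs positive cost, and the total cost is positive while the minimum possible utilitarian social cost is 0). In particular, for supermodular binary cost functions no deterministic online algorithm can achieve α-MMS or α-min-USC together with completeness for any α ≥ 1. -/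
open Finset

namespace OnlineFair

/-- The cost function charging `1` to bundles containing both `p` and `q`. -/
noncomputable def pairCost (p q : ℕ) (S : Finset ℕ) : ℝ := if p ∈ S ∧ q ∈ S then 1 else 0

lemma pairCost_nonneg (p q : ℕ) (S : Finset ℕ) : 0 ≤ pairCost p q S := by
  unfold pairCost; split_ifs <;> norm_num

lemma pairCost_eq_one {p q : ℕ} {S : Finset ℕ} (hp : p ∈ S) (hq : q ∈ S) :
    pairCost p q S = 1 := if_pos ⟨hp, hq⟩

lemma pairCost_mono (p q : ℕ) {S T : Finset ℕ} (h : S ⊆ T) : pairCost p q S ≤ pairCost p q T := by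
  unfold pairCost
  have hp := @h p
  have hq := @h q
  split_ifs <;> first | exact le_rfl | exact zero_le_one | (exfalso; tauto)

lemma supermodular_pairCost (p q : ℕ) : Supermodular (pairCost p q) := by
  intro X Y
  by_cases h1 : p ∈ X <;> by_cases h2 : q ∈ X <;> by_cases h3 : p ∈ Y <;> by_cases h4 : q ∈ Y <;>
    simp [pairCost, h1, h2, h3, h4]

lemma pairCost_insert_of_ne {p q e : ℕ} (hp : e ≠ p) (hq : e ≠ q) (X : Finset ℕ) :
    pairCost p q (insert e X) = pairCost p q X := by
  simp [pairCost, hp.symm, hq.symm]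

lemma binaryMarginals_pairCost (p q : ℕ) : BinaryMarginals (pairCost p q) := by
  intro X e
  have h := pairCost_mono p q (Finset.subset_insert e X)
  unfold pairCost at *
  split_ifs at * <;> norm_num at *

lemma supermodularBinary_pairCost (p q : ℕ) : SupermodularBinary (pairCost p q) :=
  ⟨⟨by simp [pairCost], fun _ _ h => pairCost_mono p q h⟩,
    supermodular_pairCost p q, binaryMarginals_pairCost p q⟩

lemma supermodularBinary_zero : SupermodularBinary (fun _ => 0) :=
  ⟨⟨rfl, fun _ _ _ => le_rfl⟩, fun _ _ => by simp, fun _ _ => by simp⟩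

lemma supermodularBinary_pairCost_add {p q r s : ℕ} (hpr : p ≠ r) (hps : p ≠ s) (hqr : q ≠ r)
    (hqs : q ≠ s) : SupermodularBinary (fun S => pairCost p q S + pairCost r s S) := by
  refine ⟨⟨by simp [pairCost], fun _ _ h => add_le_add (pairCost_mono p q h)
    (pairCost_mono r s h)⟩, fun X Y => ?_, fun X e => ?_⟩
  · have h1 := supermodular_pairCost p q X Y
    have h2 := supermodular_pairCost r s X Y
    dsimp only
    linarith
  · dsimp only
    by_cases h : e = p ∨ e = q
    · have hr : e ≠ r := by rcases h with rfl | rfl <;> assumption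
      have hs : e ≠ s := by rcases h with rfl | rfl <;> assumption
      rw [pairCost_insert_of_ne hr hs]
      rcases binaryMarginals_pairCost p q X e with h | h <;> rw [h]
      · exact Or.inl rfl
      · exact Or.inr (by ring)
    · push Not at h
      rw [pairCost_insert_of_ne h.1 h.2]
      rcases binaryMarginals_pairCost r s X e with h | h <;> rw [h]
      · exact Or.inl rfl
      · exact Or.inr (by ring)

lemma mem_runChores {n : ℕ} (alg : ChoresAlg n) (c : Fin n → Finset ℕ → ℝ) {k t : ℕ}
    (hk : k < t) {i : Fin n} (hi : alg k (restrictVal c k) = i) : k ∈ runChores alg c t i := by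
  induction t with
  | zero => omega
  | succ t ih =>
    simp only [runChores]
    rcases Nat.lt_succ_iff_lt_or_eq.mp hk with h | rfl
    · split_ifs
      · exact Finset.mem_insert_of_mem (ih h)
      · exact ih h
    · simp [hi]

lemma isPartition_sdiff {X T : Finset ℕ} (h : X ⊆ T) : IsPartition 2 T ![X, T \ X] := by
  refine ⟨⟨?_, ?_⟩, ?_⟩
  · simp [Fin.forall_fin_two, h]
  · simp [Fin.forall_fin_two, Finset.disjoint_sdiff, Finset.sdiff_disjoint]
  · intro e he
    by_cases hx : e ∈ X
    · exact ⟨0, hx⟩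
    · exact ⟨1, by simp [he, hx]⟩

/-- If some partition into two bundles is free for both agents while some agent incurs positive
cost, then every approximation of MMS and of min-USC fails. -/
lemma fails_of_free_partition {T : Finset ℕ} {c : Fin 2 → Finset ℕ → ℝ} {A : Fin 2 → Finset ℕ}
    (hc : ∀ i, SupermodularBinary (c i)) {i : Fin 2} (hi : 0 < c i (A i)) {X : Finset ℕ}
    (hX : X ⊆ T) (h0 : ∀ i, c i X = 0 ∧ c i (T \ X) = 0) :
    (∀ i, SupermodularBinary (c i)) ∧
      (∃ i : Fin 2, 0 < c i (A i) ∧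
        ∃ B : Fin 2 → Finset ℕ, IsPartition 2 T B ∧ ∀ j, c i (B j) = 0) ∧
      (0 < ∑ i, c i (A i)) ∧
      (∃ B : Fin 2 → Finset ℕ, IsPartition 2 T B ∧ ∑ i, c i (B i) = 0) ∧
      (∀ α : ℝ, 1 ≤ α → ¬ MMSChores 2 α c T A) ∧
      (∀ α : ℝ, 1 ≤ α → ¬ MinUSC 2 α c T A) := by
  have hB := isPartition_sdiff hX
  have hz : ∀ i j, c i ((![X, T \ X] : Fin 2 → Finset ℕ) j) = 0 := fun i =>
    Fin.forall_fin_two.mpr (h0 i)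
  have hs : 0 < ∑ i, c i (A i) := by
    refine Finset.sum_pos' (fun k _ => ?_) ⟨i, Finset.mem_univ _, hi⟩
    rw [← (hc k).1.1]
    exact (hc k).1.2 _ _ (Finset.empty_subset _)
  refine ⟨hc, ⟨i, hi, _, hB, hz i⟩, hs, ⟨_, hB, Finset.sum_eq_zero fun k _ => hz k k⟩,
    fun α _ hM => ?_, fun α _ hM => ?_⟩
  · obtain ⟨j, hj⟩ := hM i _ hB
    rw [hz, mul_zero] at hj
    exact hj.not_gt hi
  · have h := hM _ hB
    rw [Finset.sum_eq_zero fun k _ => hz k k, mul_zero] at h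
    exact h.not_gt hs

/-- for supermodular binary cost functions, no deterministic online
chores algorithm achieves `α`-MMS or `α`-min-USC together with completeness, for any
`α ≥ 1`: indeed some agent with minimax share `0` incurs positive cost, and the total
cost is positive while the minimum possible utilitarian social cost is `0`. -/
theorem chores_supermodularBinary_no_MMS_USC :
    ∀ alg : ChoresAlg 2,
    ∃ (t : ℕ) (c : Fin 2 → Finset ℕ → ℝ),
      (∀ i, SupermodularBinary (c i)) ∧
      (∃ i : Fin 2, 0 < c i (runChores alg c t i) ∧
        ∃ B : Fin 2 → Finset ℕ, IsPartition 2 (Finset.range t) B ∧ ∀ j, c i (B j) = 0) ∧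
      (0 < ∑ i, c i (runChores alg c t i)) ∧
      (∃ B : Fin 2 → Finset ℕ, IsPartition 2 (Finset.range t) B ∧ ∑ i, c i (B i) = 0) ∧
      (∀ α : ℝ, 1 ≤ α → ¬ MMSChores 2 α c (Finset.range t) (runChores alg c t)) ∧
      (∀ α : ℝ, 1 ≤ α → ¬ MinUSC 2 α c (Finset.range t) (runChores alg c t)) := by
  intro alg
  set z := alg 0 (fun _ _ => 0)
  have hrun0 : ∀ c : Fin 2 → Finset ℕ → ℝ, restrictVal c 0 = (fun _ _ => 0) →
      alg 0 (restrictVal c 0) = z := fun c h => by rw [h]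
  by_cases hw : alg 1 (fun _ _ => 0) = z
  · set c : Fin 2 → Finset ℕ → ℝ := fun i => if i = z then pairCost 0 2 else fun _ => 0 with hcdef
    by_cases hy : alg 2 (restrictVal c 2) = z
    · have h0 : alg 0 (restrictVal c 0) = z := hrun0 c (by
        funext i S; by_cases h : i = z <;> simp [restrictVal, hcdef, h, pairCost])
      refine ⟨3, c, fails_of_free_partition (i := z) (X := {0, 1}) (fun i => ?_) ?_ (by decide)
        fun i => ?_⟩
      · by_cases h : i = z
        · simpa [hcdef, h] using supermodularBinary_pairCost _ _
        · simpa [hcdef, h] using supermodularBinary_zero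
      · have h := pairCost_eq_one (mem_runChores alg c (show 0 < 3 by norm_num) h0)
          (mem_runChores alg c (show 2 < 3 by norm_num) hy)
        rw [show c z = pairCost 0 2 by simp [hcdef], h]
        exact one_pos
      · by_cases h : i = z <;> simp [hcdef, h, pairCost]
    · set d : Fin 2 → Finset ℕ → ℝ := fun i =>
        if i = z then fun S => pairCost 0 2 S + pairCost 1 3 S else pairCost 2 3 with hddef
      have h1 : alg 1 (restrictVal d 1) = z := by
        rw [← hw]; congr 1
        funext i S; by_cases h : i = z <;> simp [restrictVal, hddef, h, pairCost]
      have h2 : restrictVal d 2 = restrictVal c 2 := by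
        funext i S; by_cases h : i = z <;> simp [restrictVal, hcdef, hddef, h, pairCost]
      have hpos : 0 < d (alg 3 (restrictVal d 3)) (runChores alg d 4 (alg 3 (restrictVal d 3))) := by
        have m3 := mem_runChores alg d (show 3 < 4 by norm_num) rfl
        by_cases hx : alg 3 (restrictVal d 3) = z
        · rw [hx] at m3 ⊢
          have h := pairCost_eq_one (mem_runChores alg d (show 1 < 4 by norm_num) h1) m3
          have h' := pairCost_nonneg 0 2 (runChores alg d 4 z)
          simp only [hddef, if_true] at h h' ⊢
          linarith
        · have he : alg 2 (restrictVal d 2) = alg 3 (restrictVal d 3) := by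
            rw [h2]; omega
          have h := pairCost_eq_one (mem_runChores alg d (show 2 < 4 by norm_num) he) m3
          rw [show d (alg 3 (restrictVal d 3)) = pairCost 2 3 from if_neg hx, h]
          exact one_pos
      refine ⟨4, d, fails_of_free_partition (X := {0, 3}) (fun i => ?_) hpos (by decide)
        fun i => ?_⟩
      · by_cases h : i = z
        · simpa [hddef, h] using supermodularBinary_pairCost_add (p := 0) (q := 2) (r := 1) (s := 3)
            (by norm_num) (by norm_num) (by norm_num) (by norm_num)
        · simpa [hddef, h] using supermodularBinary_pairCost _ _
      · by_cases h : i = z <;> simp [hddef, h, pairCost]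
  · set c : Fin 2 → Finset ℕ → ℝ := fun i =>
      if i = z then pairCost 0 2 else pairCost 1 2 with hcdef
    have h0 : alg 0 (restrictVal c 0) = z := hrun0 c (by
      funext i S; by_cases h : i = z <;> simp [restrictVal, hcdef, h, pairCost])
    have h1 : restrictVal c 1 = fun _ _ => 0 := by
      funext i S; by_cases h : i = z <;> simp [restrictVal, hcdef, h, pairCost]
    have hpos : 0 < c (alg 2 (restrictVal c 2)) (runChores alg c 3 (alg 2 (restrictVal c 2))) := by
      have m2 := mem_runChores alg c (show 2 < 3 by norm_num) rfl
      by_cases hx : alg 2 (restrictVal c 2) = z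
      · have h := pairCost_eq_one
          (mem_runChores alg c (show 0 < 3 by norm_num) (h0.trans hx.symm)) m2
        rw [show c (alg 2 (restrictVal c 2)) = pairCost 0 2 from if_pos hx, h]
        exact one_pos
      · have he : alg 1 (restrictVal c 1) = alg 2 (restrictVal c 2) := by
          rw [h1]; omega
        have h := pairCost_eq_one (mem_runChores alg c (show 1 < 3 by norm_num) he) m2
        rw [show c (alg 2 (restrictVal c 2)) = pairCost 1 2 from if_neg hx, h]
        exact one_pos
    refine ⟨3, c, fails_of_free_partition (X := {0, 1}) (fun i => ?_) hpos (by decide)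
      fun i => ?_⟩
    · by_cases h : i = z <;> simpa [hcdef, h] using supermodularBinary_pairCost _ _
    · by_cases h : i = z <;> simp [hcdef, h, pairCost]

end OnlineFair
end
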